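/- Let Ω ⊂ ℂ be a bounded hyperbolic domain, fix a base point x_0 ∈ Ω, and let φ : (0,∞) → (0,∞) be a strictly increasing function with φ(t) → ∞ as t → ∞ such that ∫_0^∞ dt/φ⁻¹(t) < ∞. If the quasihyperbolic metric satisfies k_Ω(x_0, x) ≤ φ(δ_Ω(x_0)/δ_Ω(x)) for all x ∈ Ω, then Ω is an H-visibility domain. -/

import Mathlib

open Metric Set Filter Topology MeasureTheory
open scoped NNReal ENNReal

noncomputable section

variable {E : Type*} [NormedAddCommGroup E] [NormedSpace ℝ E]

/-- The quasihyperbolic length of a path `γ : [a, b] → Ω`, i.e. `∫ ‖γ'(t)‖ / δ_Ω(γ t) dt`. -/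
def qhLength (Ω : Set E) (γ : ℝ → E) (a b : ℝ) : ℝ :=
  ∫ t in a..b, ‖deriv γ t‖ / infDist (γ t) Ωᶜ

/-- Admissible (Lipschitz, i.e. rectifiable) paths joining `x` to `y` inside `Ω`. -/
def qhAdmissible (Ω : Set E) (x y : E) (γ : ℝ → E) (a b : ℝ) : Prop :=
  a ≤ b ∧ γ a = x ∧ γ b = y ∧ (∀ t ∈ Icc a b, γ t ∈ Ω) ∧
    ∃ K : ℝ≥0, LipschitzOnWith K γ (Icc a b)

/-- The quasihyperbolic distance `k_Ω` on a domain `Ω`. -/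
def qhDist (Ω : Set E) (x y : E) : ℝ :=
  sInf { L : ℝ | ∃ γ a b, qhAdmissible Ω x y γ a b ∧ L = qhLength Ω γ a b }

/-- `γ` is a (unit-speed) quasihyperbolic geodesic on the parameter set `s`. -/
def IsQHGeodesicOn (Ω : Set E) (γ : ℝ → E) (s : Set ℝ) : Prop :=
  (∀ t ∈ s, γ t ∈ Ω) ∧ ∀ a ∈ s, ∀ b ∈ s, qhDist Ω (γ a) (γ b) = |a - b|

/-- `Ω` is a QH-visibility domain: any two distinct Euclidean boundary points have
neighbourhoods with disjoint closures together with a compact subset of `Ω` which is met by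
every quasihyperbolic geodesic joining the two neighbourhoods. -/
def QHVisibilityDomain (Ω : Set E) : Prop :=
  ∀ p ∈ frontier Ω, ∀ q ∈ frontier Ω, p ≠ q →
    ∃ U V : Set E, IsOpen U ∧ IsOpen V ∧ p ∈ U ∧ q ∈ V ∧
      closure U ∩ closure V = ∅ ∧
      ∃ K : Set E, IsCompact K ∧ K ⊆ Ω ∧
        ∀ (γ : ℝ → E) (T : ℝ), 0 ≤ T → IsQHGeodesicOn Ω γ (Icc 0 T) →
          γ 0 ∈ U → γ T ∈ V → ∃ t ∈ Icc 0 T, γ t ∈ K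

/-- `Ω ⊊ ℂ` is a hyperbolic domain: its complement contains at least two points. -/
def IsHyperbolicDomain (Ω : Set ℂ) : Prop :=
  ∃ a b : ℂ, a ≠ b ∧ a ∉ Ω ∧ b ∉ Ω

/-- The hyperbolic density of `Ω` at `w` (curvature `-4` normalization), characterized via
Schwarz–Pick: the reciprocal of the largest derivative at `0` of a holomorphic map of the
unit disk into `Ω` sending `0` to `w`. -/
def hypDensity (Ω : Set ℂ) (w : ℂ) : ℝ :=
  1 / sSup { r : ℝ | ∃ f : ℂ → ℂ, DifferentiableOn ℂ f (ball (0 : ℂ) 1) ∧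
      MapsTo f (ball (0 : ℂ) 1) Ω ∧ f 0 = w ∧ r = ‖deriv f 0‖ }

/-- The hyperbolic length of a path in `Ω`. -/
def hypLength (Ω : Set ℂ) (γ : ℝ → ℂ) (a b : ℝ) : ℝ :=
  ∫ t in a..b, hypDensity Ω (γ t) * ‖deriv γ t‖

/-- The hyperbolic distance `h_Ω` on a hyperbolic domain `Ω ⊆ ℂ`. -/
def hypDist (Ω : Set ℂ) (x y : ℂ) : ℝ :=
  sInf { L : ℝ | ∃ γ a b, qhAdmissible Ω x y γ a b ∧ L = hypLength Ω γ a b }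

/-- `γ` is a (unit-speed) hyperbolic geodesic on the parameter set `s`. -/
def IsHypGeodesicOn (Ω : Set ℂ) (γ : ℝ → ℂ) (s : Set ℝ) : Prop :=
  (∀ t ∈ s, γ t ∈ Ω) ∧ ∀ a ∈ s, ∀ b ∈ s, hypDist Ω (γ a) (γ b) = |a - b|

/-- `Ω` is an H-visibility domain (visibility with respect to the hyperbolic metric). -/
def HVisibilityDomain (Ω : Set ℂ) : Prop :=
  ∀ p ∈ frontier Ω, ∀ q ∈ frontier Ω, p ≠ q →
    ∃ U V : Set ℂ, IsOpen U ∧ IsOpen V ∧ p ∈ U ∧ q ∈ V ∧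
      closure U ∩ closure V = ∅ ∧
      ∃ K : Set ℂ, IsCompact K ∧ K ⊆ Ω ∧
        ∀ (γ : ℝ → ℂ) (T : ℝ), 0 ≤ T → IsHypGeodesicOn Ω γ (Icc 0 T) →
          γ 0 ∈ U → γ T ∈ V → ∃ t ∈ Icc 0 T, γ t ∈ K

/-! ### Holomorphic logarithms and the theorems of Bloch and Landau -/

theorem exists_holomorphic_log {f : ℂ → ℂ} (hf : DifferentiableOn ℂ f (ball 0 1))
    (hf0 : ∀ z ∈ ball (0 : ℂ) 1, f z ≠ 0) {w : ℂ} (hw : Complex.exp w = f 0) :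
    ∃ g : ℂ → ℂ, DifferentiableOn ℂ g (ball 0 1) ∧ g 0 = w ∧
      ∀ z ∈ ball (0 : ℂ) 1, Complex.exp (g z) = f z := by
  have hq : DifferentiableOn ℂ (fun z => deriv f z / f z) (ball 0 1) :=
    (hf.deriv isOpen_ball).div hf hf0
  obtain ⟨g, hg0, hg⟩ := hq.isExactOn_ball.with_val_at 0 w
  refine ⟨g, fun z hz => (hg z hz).differentiableAt.differentiableWithinAt, hg0, ?_⟩
  have hder : ∀ z ∈ ball (0 : ℂ) 1,
      HasDerivAt (fun z => f z * Complex.exp (-g z)) 0 z := by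
    intro z hz
    have hfz := (hf.differentiableAt (isOpen_ball.mem_nhds hz)).hasDerivAt
    convert! hfz.mul (hg z hz).neg.cexp using 1
    have := hf0 z hz
    field_simp
    ring
  intro z hz
  have h0 : (0 : ℂ) ∈ ball (0 : ℂ) 1 := by simp
  have hc := isOpen_ball.is_const_of_deriv_eq_zero (convex_ball (0 : ℂ) 1).isPreconnected
    (fun z hz => (hder z hz).differentiableAt.differentiableWithinAt)
    (fun z hz => (hder z hz).deriv) hz h0
  simp only [hg0, ← hw, ← Complex.exp_add, add_neg_cancel, Complex.exp_zero] at hc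
  rw [Complex.exp_neg] at hc
  field_simp [Complex.exp_ne_zero] at hc
  exact hc.symm

/-- A weak form of Bloch's theorem: a holomorphic function on the unit disc whose omitted values
are `d`-dense has derivative at most `128 d` at the origin. -/
theorem norm_deriv_le_of_omitted_dense {h : ℂ → ℂ} (hh : DifferentiableOn ℂ h (ball 0 1)) {d : ℝ}
    (hd : ∀ w, ∃ p, dist p w < d ∧ ∀ z ∈ ball (0 : ℂ) 1, h z ≠ p) :
    ‖deriv h 0‖ ≤ 128 * d := by
  have hdpos : 0 < d := by
    obtain ⟨p, hp, -⟩ := hd 0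
    exact dist_nonneg.trans_lt hp
  have hh' : DifferentiableOn ℂ (deriv h) (ball 0 1) := hh.deriv isOpen_ball
  have hsub : closedBall (0 : ℂ) (1 / 2) ⊆ ball 0 1 := closedBall_subset_ball (by norm_num)
  have hcont : ContinuousOn (fun z : ℂ => (1 / 2 - ‖z‖) * ‖deriv h z‖) (closedBall 0 (1 / 2)) :=
    (by fun_prop : Continuous fun z : ℂ => 1 / 2 - ‖z‖).continuousOn.mul
      (hh'.continuousOn.mono hsub).norm
  obtain ⟨c, hc, hmax⟩ := (isCompact_closedBall (0 : ℂ) (1 / 2)).exists_isMaxOn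
    ⟨0, by simp⟩ hcont
  have hmax0 : 1 / 2 * ‖deriv h 0‖ ≤ (1 / 2 - ‖c‖) * ‖deriv h c‖ := by
    simpa using hmax (show (0 : ℂ) ∈ closedBall (0 : ℂ) (1 / 2) by simp)
  rcases (norm_nonneg (deriv h 0)).eq_or_lt with h0 | h0
  · rw [← h0]; positivity
  have hc' : ‖c‖ ≤ 1 / 2 := by simpa using hc
  set s := 1 / 2 - ‖c‖ with hs
  set m := ‖deriv h c‖ with hm
  have hspos : 0 < s := by
    rcases (show 0 ≤ s by linarith).eq_or_lt with h1 | h1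
    · rw [← h1] at hmax0; linarith
    · exact h1
  have hmpos : 0 < m := by
    rcases (norm_nonneg (deriv h c)).eq_or_lt with h1 | h1
    · rw [hm, ← h1] at hmax0; linarith
    · exact h1
  have hball : ∀ z ∈ ball c (s / 2), ‖z‖ < 1 / 2 - s / 2 := by
    intro z hz
    have h1 : ‖z - c‖ < s / 2 := by simpa [dist_eq_norm] using hz
    have h2 : ‖z‖ ≤ ‖z - c‖ + ‖c‖ := by simpa using norm_add_le (z - c) c
    linarith
  have hball1 : ball c (s / 2) ⊆ ball (0 : ℂ) 1 := by
    intro z hz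
    have := hball z hz
    simp only [mem_ball, dist_zero_right]; linarith
  have hbd : MapsTo (deriv h) (ball c (s / 2)) (closedBall (deriv h c) (4 * m)) := by
    intro z hz
    have h1 := hball z hz
    have h2 : (1 / 2 - ‖z‖) * ‖deriv h z‖ ≤ s * m :=
      hmax (show z ∈ closedBall (0 : ℂ) (1 / 2) by simp; linarith)
    have h3 : ‖deriv h z‖ ≤ 2 * m := by
      have : s / 2 * ‖deriv h z‖ ≤ s * m := by
        refine le_trans ?_ h2
        gcongr; linarith
      nlinarith
    rw [mem_closedBall, dist_eq_norm]
    have := norm_sub_le (deriv h z) (deriv h c)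
    linarith
  have hlip : ∀ z ∈ closedBall c (s / 16), ‖deriv h z - deriv h c‖ ≤ m / 2 := by
    intro z hz
    have hz' : dist z c ≤ s / 16 := hz
    have h1 := Complex.dist_le_div_mul_dist_of_mapsTo_ball (hh'.mono hball1) hbd
      (show z ∈ ball c (s / 2) by rw [mem_ball]; linarith)
    rw [← dist_eq_norm]
    calc _ ≤ 4 * m / (s / 2) * dist z c := h1
      _ ≤ 4 * m / (s / 2) * (s / 16) := by gcongr
      _ = m / 2 := by field_simp; norm_num
  have hcl : closedBall c (s / 16) ⊆ ball (0 : ℂ) 1 :=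
    (closedBall_subset_ball (by linarith)).trans hball1
  have hdiff : ∀ z ∈ closedBall c (s / 16), DifferentiableAt ℂ h z :=
    fun z hz => hh.differentiableAt (isOpen_ball.mem_nhds (hcl hz))
  have hlow : ∀ z ∈ sphere c (s / 16), m * s / 32 ≤ ‖h z - h c‖ := by
    intro z hz
    have hz1 : z ∈ closedBall c (s / 16) := sphere_subset_closedBall hz
    have hz2 : ‖z - c‖ = s / 16 := by simpa [dist_eq_norm] using hz
    have h1 := (convex_closedBall c (s / 16)).norm_image_sub_le_of_norm_hasDerivWithin_le
      (f := fun z => h z - deriv h c * z) (f' := fun z => deriv h z - deriv h c * 1) (C := m / 2)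
      (fun x hx => ((hdiff x hx).hasDerivAt.sub
        ((hasDerivAt_id x).const_mul (deriv h c))).hasDerivWithinAt)
      (fun x hx => by simpa using hlip x hx)
      (mem_closedBall_self (by positivity)) hz1
    have h2 : ‖deriv h c * (z - c)‖ = m * (s / 16) := by rw [norm_mul, hz2]
    have h3 : ‖deriv h c * (z - c)‖ ≤ ‖h z - h c‖
        + ‖(h z - deriv h c * z) - (h c - deriv h c * c)‖ := by
      have := norm_sub_le (h z - h c) ((h z - deriv h c * z) - (h c - deriv h c * c))
      refine le_trans (le_of_eq ?_) this
      congr 1; ring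
    rw [hz2] at h1
    linarith
  have hder : deriv h c ≠ 0 := norm_pos_iff.1 hmpos
  have hfreq : ∃ᶠ z in 𝓝 c, h z ≠ h c :=
    ((hdiff c (mem_closedBall_self (by positivity))).hasDerivAt.eventually_ne
      hder).frequently.filter_mono nhdsWithin_le_nhds
  have himg := (show DiffContOnCl ℂ h (ball c (s / 16)) from
    DifferentiableOn.diffContOnCl (by
      rw [closure_ball _ (by positivity)]
      exact hh.mono hcl)).ball_subset_image_closedBall (by positivity) hlow hfreq
  obtain ⟨p, hp, hpo⟩ := hd (h c)
  have : m * s / 32 / 2 ≤ d := by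
    by_contra hlt
    obtain ⟨z, hz, hzp⟩ := himg (show p ∈ ball (h c) (m * s / 32 / 2) by
      rw [mem_ball]; linarith)
    exact hpo z (hcl hz) hzp
  linarith

theorem exists_odd_cosh_near (w : ℂ) :
    ∃ p : ℂ, dist p w < 6 ∧ ∃ n : ℤ, Complex.cosh p = 2 * n + 1 := by
  obtain ⟨x, hx, n, hn⟩ : ∃ x : ℝ, |x - (|w.re|)| ≤ 2 ∧ ∃ n : ℤ, Real.cosh x = 2 * n + 1 := by
    set c := Real.cosh |w.re| with hc
    have hc1 : 1 ≤ c := Real.one_le_cosh _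
    set n := ⌈(c - 1) / 2⌉ with hn
    have hn1 : c ≤ 2 * n + 1 := by linarith [Int.le_ceil ((c - 1) / 2)]
    have hn2 : (2 * n + 1 : ℝ) ≤ c + 2 := by linarith [Int.ceil_lt_add_one ((c - 1) / 2)]
    have hk1 : (1 : ℝ) ≤ 2 * n + 1 := by linarith
    refine ⟨Real.arcosh (2 * n + 1), ?_, n, Real.cosh_arcosh hk1⟩
    have hl : |w.re| ≤ Real.arcosh (2 * n + 1) := by
      rw [← Real.arcosh_cosh (abs_nonneg w.re)]
      exact (Real.arcosh_le_arcosh (by linarith) (by linarith)).2 hn1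
    have h2 : 3 ≤ Real.cosh 2 := by
      have h3 : Real.exp 2 = Real.exp 1 ^ 2 := by rw [← Real.exp_nat_mul]; norm_num
      rw [Real.cosh_eq]
      nlinarith [Real.exp_one_gt_d9, Real.exp_pos (-2)]
    have hu : Real.arcosh (2 * n + 1) ≤ |w.re| + 2 := by
      rw [← Real.arcosh_cosh (show 0 ≤ |w.re| + 2 by positivity)]
      refine (Real.arcosh_le_arcosh (by linarith) (Real.cosh_pos _)).2 ?_
      rw [Real.cosh_add, ← hc]
      have h3 : 0 ≤ Real.sinh |w.re| * Real.sinh 2 :=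
        mul_nonneg (Real.sinh_nonneg_iff.2 (abs_nonneg _)) (Real.sinh_nonneg_iff.2 (by norm_num))
      nlinarith
    rw [abs_le]; constructor <;> linarith
  obtain ⟨y, hy, hyn⟩ : ∃ y : ℝ, |y - w.re| ≤ 2 ∧ Real.cosh y = 2 * n + 1 := by
    rcases abs_cases w.re with ⟨h, -⟩ | ⟨h, -⟩
    · exact ⟨x, by rwa [h] at hx, hn⟩
    · refine ⟨-x, ?_, by rwa [Real.cosh_neg]⟩
      rw [h] at hx
      rwa [← abs_neg, show -(-x - w.re) = x - -w.re by ring]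
  set m := round (w.im / Real.pi) with hm
  have hmr := abs_sub_round (w.im / Real.pi)
  refine ⟨y + (m * Real.pi : ℝ) * Complex.I, ?_, ?_⟩
  · have h1 : |m * Real.pi - w.im| ≤ Real.pi / 2 := by
      have : m * Real.pi - w.im = -((w.im / Real.pi - m) * Real.pi) := by
        field_simp; ring
      rw [this, abs_neg, abs_mul, abs_of_pos Real.pi_pos]
      nlinarith [Real.pi_pos]
    rw [dist_eq_norm]
    refine (Complex.norm_le_abs_re_add_abs_im _).trans_lt ?_
    simp only [Complex.sub_re, Complex.add_re, Complex.ofReal_re, Complex.mul_re, Complex.I_re,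
      Complex.ofReal_im, Complex.sub_im, Complex.add_im, Complex.mul_im, Complex.I_im, mul_zero,
      mul_one, sub_zero, add_zero, zero_add]
    linarith [Real.pi_lt_four]
  · rw [Complex.cosh_add, Complex.cosh_mul_I, Complex.sinh_mul_I, ← Complex.ofReal_sin,
      Real.sin_int_mul_pi, ← Complex.ofReal_cos, Real.cos_int_mul_pi, ← Complex.ofReal_cosh, hyn]
    rcases Int.even_or_odd m with he | ho
    · exact ⟨n, by rw [he.neg_one_zpow]; push_cast; ring⟩
    · exact ⟨-n - 1, by rw [ho.neg_one_zpow]; push_cast; ring⟩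

/-- A weak form of Landau's theorem. -/
theorem norm_deriv_le_of_omits_zero_one {f : ℂ → ℂ} (hf : DifferentiableOn ℂ f (ball 0 1))
    (hf0 : ∀ z ∈ ball (0 : ℂ) 1, f z ≠ 0) (hf1 : ∀ z ∈ ball (0 : ℂ) 1, f z ≠ 1)
    (hlow : 1 / 4 ≤ ‖f 0‖) (hup : ‖f 0‖ ≤ 1 / 2) : ‖deriv f 0‖ ≤ 10000 := by
  have h0 : (0 : ℂ) ∈ ball (0 : ℂ) 1 := by simp
  obtain ⟨L, hL, hL0, hLexp⟩ := exists_holomorphic_log hf hf0 (Complex.exp_log (hf0 0 h0))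
  have hpiI : (Real.pi * Complex.I : ℂ) ≠ 0 := by simp [Real.pi_ne_zero]
  let Q : ℂ → ℂ := fun z => L z / (Real.pi * Complex.I) - 1
  have hQ : DifferentiableOn ℂ Q (ball 0 1) := (hL.div_const _).sub_const 1
  have hQodd : ∀ z ∈ ball (0 : ℂ) 1, ∀ n : ℤ, Q z ≠ 2 * n + 1 := by
    intro z hz n h
    have h1 : L z = (n + 1 : ℤ) * (2 * Real.pi * Complex.I) := by
      have : L z / (Real.pi * Complex.I) = 2 * n + 2 := by linear_combination h
      rw [div_eq_iff hpiI] at this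
      rw [this]; push_cast; ring
    apply hf1 z hz
    rw [← hLexp z hz, h1, Complex.exp_int_mul_two_pi_mul_I]
  have hR : ∀ z ∈ ball (0 : ℂ) 1, 1 - Q z ^ 2 ≠ 0 := by
    intro z hz h
    have h1 := hQodd z hz 0
    have h2 := hQodd z hz (-1)
    have h3 : (Q z - 1) * (Q z + 1) = 0 := by linear_combination -h
    rcases mul_eq_zero.1 h3 with h4 | h4
    · exact h1 (by push_cast; linear_combination h4)
    · exact h2 (by push_cast; linear_combination h4)
  have hRd : DifferentiableOn ℂ (fun z => 1 - Q z ^ 2) (ball 0 1) := (hQ.pow 2).const_sub 1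
  obtain ⟨l, hl, -, hlexp⟩ := exists_holomorphic_log hRd hR (Complex.exp_log (hR 0 h0))
  let S : ℂ → ℂ := fun z => Complex.exp (l z / 2)
  have hS : DifferentiableOn ℂ S (ball 0 1) := (hl.div_const 2).cexp
  have hSsq : ∀ z ∈ ball (0 : ℂ) 1, S z ^ 2 = 1 - Q z ^ 2 := by
    intro z hz
    rw [← hlexp z hz, ← Complex.exp_nat_mul]
    congr 1; push_cast; ring
  have hN : ∀ z ∈ ball (0 : ℂ) 1,
      (Q z + Complex.I * S z) * (Q z - Complex.I * S z) = 1 := by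
    intro z hz
    linear_combination hSsq z hz - S z ^ 2 * Complex.I_sq
  have hNd : DifferentiableOn ℂ (fun z => Q z + Complex.I * S z) (ball 0 1) :=
    hQ.add (hS.const_mul _)
  have hN0 : ∀ z ∈ ball (0 : ℂ) 1, Q z + Complex.I * S z ≠ 0 :=
    fun z hz => left_ne_zero_of_mul_eq_one (hN z hz)
  obtain ⟨H, hH, -, hHexp⟩ := exists_holomorphic_log hNd hN0 (Complex.exp_log (hN0 0 h0))
  have hHneg : ∀ z ∈ ball (0 : ℂ) 1, Complex.exp (-H z) = Q z - Complex.I * S z := by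
    intro z hz
    rw [Complex.exp_neg, hHexp z hz]
    exact inv_eq_of_mul_eq_one_right (hN z hz)
  have hcosh : ∀ z ∈ ball (0 : ℂ) 1, Complex.cosh (H z) = Q z := by
    intro z hz
    rw [Complex.cosh, hHexp z hz, hHneg z hz]; ring
  have hsinh : Complex.sinh (H 0) = Complex.I * S 0 := by
    rw [Complex.sinh, hHexp 0 h0, hHneg 0 h0]; ring
  have hHder : ‖deriv H 0‖ ≤ 128 * 6 := by
    refine norm_deriv_le_of_omitted_dense hH fun w => ?_
    obtain ⟨p, hp, n, hn⟩ := exists_odd_cosh_near w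
    refine ⟨p, hp, fun z hz h => hQodd z hz n ?_⟩
    rw [← hcosh z hz, h, hn]
  have hHd := (hH.differentiableAt (isOpen_ball.mem_nhds h0)).hasDerivAt
  have hfL : HasDerivAt f (f 0 * (Real.pi * Complex.I * (Complex.I * S 0 * deriv H 0))) 0 := by
    have h1 : HasDerivAt
        (fun z => Complex.exp (Real.pi * Complex.I * (Complex.cosh (H z) + 1)))
        (Complex.exp (Real.pi * Complex.I * (Complex.cosh (H 0) + 1)) *
          (Real.pi * Complex.I * (Complex.sinh (H 0) * deriv H 0))) 0 :=
      ((hHd.ccosh.add_const 1).const_mul _).cexp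
    have h2 : ∀ z ∈ ball (0 : ℂ) 1,
        Complex.exp (Real.pi * Complex.I * (Complex.cosh (H z) + 1)) = f z := by
      intro z hz
      rw [hcosh z hz, ← hLexp z hz]
      congr 1
      simp only [Q]
      field_simp
      ring
    rw [h2 0 h0, hsinh] at h1
    exact h1.congr_of_eventuallyEq
      (Filter.eventually_of_mem (isOpen_ball.mem_nhds h0) fun z hz => (h2 z hz).symm)
  have hL0norm : ‖L 0‖ ≤ 6 := by
    rw [hL0]
    refine (Complex.norm_le_abs_re_add_abs_im _).trans ?_
    rw [Complex.log_re, Complex.log_im]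
    have h1 := Complex.abs_arg_le_pi (f 0)
    have h2 : |Real.log ‖f 0‖| ≤ 2 := by
      rw [abs_le]
      constructor
      · rw [Real.le_log_iff_exp_le (by linarith)]
        have h3 : Real.exp (-2) = (Real.exp 1 ^ 2)⁻¹ := by
          rw [← Real.exp_nat_mul, ← Real.exp_neg]; norm_num
        have h4 : (4 : ℝ) ≤ Real.exp 1 ^ 2 := by nlinarith [Real.add_one_le_exp (1 : ℝ)]
        rw [h3]
        refine le_trans ?_ hlow
        rw [one_div]
        exact inv_anti₀ (by norm_num) h4
      · exact (Real.log_nonpos (norm_nonneg _) (by linarith)).trans (by norm_num)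
    linarith [Real.pi_lt_four]
  have hQ0 : ‖Q 0‖ ≤ 3 := by
    have h1 : ‖L 0 / (Real.pi * Complex.I)‖ ≤ 2 := by
      rw [norm_div, norm_mul, Complex.norm_I, mul_one, Complex.norm_real,
        Real.norm_of_nonneg Real.pi_pos.le, div_le_iff₀ Real.pi_pos]
      linarith [Real.pi_gt_three]
    have h2 := norm_sub_le (L 0 / (Real.pi * Complex.I)) 1
    simp only [norm_one] at h2
    show ‖L 0 / (Real.pi * Complex.I) - 1‖ ≤ 3
    linarith
  have hS0 : ‖S 0‖ ≤ 4 := by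
    have h1 : ‖S 0‖ ^ 2 ≤ 1 + ‖Q 0‖ ^ 2 := by
      rw [← norm_pow, hSsq 0 h0]
      exact (norm_sub_le _ _).trans_eq (by rw [norm_one, norm_pow])
    nlinarith [norm_nonneg (S 0), norm_nonneg (Q 0)]
  rw [hfL.deriv]
  simp only [norm_mul, Complex.norm_I, Complex.norm_real, Real.norm_of_nonneg Real.pi_pos.le,
    one_mul, mul_one]
  calc ‖f 0‖ * (Real.pi * (‖S 0‖ * ‖deriv H 0‖))
      ≤ 1 / 2 * (4 * (4 * (128 * 6))) := by
        gcongr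
        exact Real.pi_lt_four.le
    _ ≤ 10000 := by norm_num

/-! ### Bounds for the hyperbolic density -/

/-- The derivatives at the origin of holomorphic maps of the unit disc into `Ω` centred at `w`. -/
def discDerivs (Ω : Set ℂ) (w : ℂ) : Set ℝ :=
  { r : ℝ | ∃ f : ℂ → ℂ, DifferentiableOn ℂ f (ball (0 : ℂ) 1) ∧
      MapsTo f (ball (0 : ℂ) 1) Ω ∧ f 0 = w ∧ r = ‖deriv f 0‖ }

theorem le_of_mem_discDerivs {Ω : Set ℂ} {R : ℝ} (hR : ∀ z ∈ Ω, ‖z‖ ≤ R) {w : ℂ} {r : ℝ}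
    (hr : r ∈ discDerivs Ω w) : r ≤ 2 * R := by
  obtain ⟨f, hf, hm, -, rfl⟩ := hr
  have hsub : closedBall (0 : ℂ) (1 / 2) ⊆ ball 0 1 := closedBall_subset_ball (by norm_num)
  have h := Complex.norm_deriv_le_of_forall_mem_sphere_norm_le (c := 0) (R := 1 / 2) (f := f)
    (C := R) (by norm_num)
    (DifferentiableOn.diffContOnCl (by
      rw [closure_ball _ (by norm_num)]; exact hf.mono hsub))
    (fun z hz => hR _ (hm (hsub (sphere_subset_closedBall hz))))
  linarith [h, show R / (1 / 2) = 2 * R by ring]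

theorem discDerivs_bddAbove {Ω : Set ℂ} (hB : Bornology.IsBounded Ω) (w : ℂ) :
    BddAbove (discDerivs Ω w) := by
  obtain ⟨R, hR⟩ := hB.exists_norm_le
  exact ⟨2 * R, fun r hr => le_of_mem_discDerivs hR hr⟩

theorem infDist_mem_discDerivs {Ω : Set ℂ} {w : ℂ} (hpos : 0 < infDist w Ωᶜ) :
    infDist w Ωᶜ ∈ discDerivs Ω w := by
  set δ := infDist w Ωᶜ with hδ
  refine ⟨fun z => w + δ * z, by fun_prop, ?_, by simp, ?_⟩
  · intro z hz
    apply ball_infDist_compl_subset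
    have : ‖z‖ < 1 := by simpa using hz
    rw [mem_ball, dist_eq_norm, add_sub_cancel_left, norm_mul, Complex.norm_real,
      Real.norm_of_nonneg hpos.le, ← hδ]
    nlinarith
  · have h : HasDerivAt (fun z : ℂ => w + δ * z) (δ * 1) 0 :=
      ((hasDerivAt_id _).const_mul _).const_add _
    rw [h.deriv, mul_one, Complex.norm_real, Real.norm_of_nonneg hpos.le]

theorem infDist_compl_pos {Ω : Set ℂ} (hO : IsOpen Ω) (hne : Ωᶜ.Nonempty) {w : ℂ} (hw : w ∈ Ω) :
    0 < infDist w Ωᶜ :=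
  (hO.isClosed_compl.notMem_iff_infDist_pos hne).1 (by simpa using hw)

theorem nonempty_compl_of_isBounded {Ω : Set ℂ} (hB : Bornology.IsBounded Ω) : Ωᶜ.Nonempty := by
  rw [nonempty_compl]
  rintro rfl
  exact NormedSpace.unbounded_univ ℂ ℂ hB

theorem infDist_le_sSup_discDerivs {Ω : Set ℂ} (hO : IsOpen Ω) (hB : Bornology.IsBounded Ω) {w : ℂ}
    (hw : w ∈ Ω) : infDist w Ωᶜ ≤ sSup (discDerivs Ω w) :=
  le_csSup (discDerivs_bddAbove hB w)
    (infDist_mem_discDerivs (infDist_compl_pos hO (nonempty_compl_of_isBounded hB) hw))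

theorem sSup_discDerivs_nonneg (Ω : Set ℂ) (w : ℂ) : 0 ≤ sSup (discDerivs Ω w) :=
  Real.sSup_nonneg fun _ ⟨_, _, _, _, hr⟩ => hr ▸ norm_nonneg _

theorem hypDensity_nonneg (Ω : Set ℂ) (w : ℂ) : 0 ≤ hypDensity Ω w :=
  one_div_nonneg.2 (sSup_discDerivs_nonneg Ω w)

theorem hypDensity_le {Ω : Set ℂ} (hO : IsOpen Ω) (hB : Bornology.IsBounded Ω) {w : ℂ}
    (hw : w ∈ Ω) : hypDensity Ω w ≤ 1 / infDist w Ωᶜ :=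
  one_div_le_one_div_of_le (infDist_compl_pos hO (nonempty_compl_of_isBounded hB) hw)
    (infDist_le_sSup_discDerivs hO hB hw)

theorem le_hypDensity {Ω : Set ℂ} (hO : IsOpen Ω) (hB : Bornology.IsBounded Ω) {w : ℂ}
    (hw : w ∈ Ω) {C : ℝ} (hC : ∀ r ∈ discDerivs Ω w, r ≤ C) : 1 / C ≤ hypDensity Ω w := by
  have hpos := infDist_compl_pos hO (nonempty_compl_of_isBounded hB) hw
  exact one_div_le_one_div_of_le (hpos.trans_le (infDist_le_sSup_discDerivs hO hB hw))
    (csSup_le ⟨_, infDist_mem_discDerivs hpos⟩ hC)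

/-- Domains omitting `a` and `b` have hyperbolic density bounded below, at the scale `‖b - a‖`, on
the annulus of radii `‖b - a‖ / 4` and `‖b - a‖ / 2` around `a`. -/
theorem le_hypDensity_of_notMem {Ω : Set ℂ} (hO : IsOpen Ω) (hB : Bornology.IsBounded Ω) {a b : ℂ}
    (ha : a ∉ Ω) (hb : b ∉ Ω) (hab : a ≠ b) {w : ℂ} (hw : w ∈ Ω)
    (hlow : ‖b - a‖ / 4 ≤ ‖w - a‖) (hup : ‖w - a‖ ≤ ‖b - a‖ / 2) :
    1 / (10000 * ‖b - a‖) ≤ hypDensity Ω w := by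
  have hba : b - a ≠ 0 := sub_ne_zero.2 hab.symm
  have hn : 0 < ‖b - a‖ := norm_pos_iff.2 hba
  refine le_hypDensity hO hB hw ?_
  rintro r ⟨f, hf, hm, h0, rfl⟩
  have hnorm : ‖(f 0 - a) / (b - a)‖ = ‖w - a‖ / ‖b - a‖ := by rw [norm_div, h0]
  have h := norm_deriv_le_of_omits_zero_one (f := fun z => (f z - a) / (b - a))
    ((hf.sub_const a).div_const _)
    (fun z hz hz0 => by
      rw [div_eq_zero_iff, or_iff_left hba, sub_eq_zero] at hz0
      exact ha (hz0 ▸ hm hz))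
    (fun z hz hz1 => by
      rw [div_eq_one_iff_eq hba, sub_left_inj] at hz1
      exact hb (hz1 ▸ hm hz))
    (by rw [hnorm, le_div_iff₀ hn]; linarith) (by rw [hnorm, div_le_iff₀ hn]; linarith)
  rw [deriv_div_const, deriv_sub_const, norm_div, div_le_iff₀ hn] at h
  exact h

theorem lowerSemicontinuous_sSup_discDerivs {Ω : Set ℂ} (hO : IsOpen Ω)
    (hB : Bornology.IsBounded Ω) : LowerSemicontinuous fun w => sSup (discDerivs Ω w) := by
  intro w y hy
  by_cases hy0 : y < 0
  · exact Eventually.of_forall fun w' => hy0.trans_le (sSup_discDerivs_nonneg Ω w')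
  push Not at hy0
  have hne : (discDerivs Ω w).Nonempty := by
    by_contra h
    rw [not_nonempty_iff_eq_empty] at h
    simp only [h, Real.sSup_empty] at hy
    linarith
  obtain ⟨r, ⟨f, hf, hm, h0, rfl⟩, hr⟩ := exists_lt_of_lt_csSup hne hy
  have hrpos : 0 < ‖deriv f 0‖ := hy0.trans_lt hr
  obtain ⟨t, ht0, ht1⟩ := exists_between ((div_lt_one hrpos).2 hr)
  rw [div_lt_iff₀ hrpos] at ht0
  have htpos : 0 < t := by
    by_contra h
    nlinarith
  have hsub : closedBall (0 : ℂ) t ⊆ ball 0 1 := closedBall_subset_ball ht1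
  obtain ⟨ε, hε, hth⟩ := ((isCompact_closedBall (0 : ℂ) t).image_of_continuousOn
    (hf.continuousOn.mono hsub)).exists_thickening_subset_open hO
      ((hm.mono_left hsub).image_subset)
  filter_upwards [ball_mem_nhds w hε] with w' hw'
  have hmap : ∀ z ∈ ball (0 : ℂ) 1, (t : ℂ) * z ∈ closedBall (0 : ℂ) t := by
    intro z hz
    have : ‖z‖ < 1 := by simpa using hz
    rw [mem_closedBall, dist_zero_right, norm_mul, Complex.norm_real,
      Real.norm_of_nonneg htpos.le]
    nlinarith
  have h0' : HasDerivAt f (deriv f 0) ((t : ℂ) * 0) := by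
    rw [mul_zero]
    exact (hf.differentiableAt (ball_mem_nhds 0 one_pos)).hasDerivAt
  have hder : HasDerivAt (fun z : ℂ => f (t * z) + (w' - w)) (deriv f 0 * (t * 1)) 0 :=
    (h0'.comp (0 : ℂ) ((hasDerivAt_id (0 : ℂ)).const_mul (t : ℂ))).add_const _
  refine ht0.trans_le (le_csSup (discDerivs_bddAbove hB w')
    ⟨fun z => f (t * z) + (w' - w), ?_, ?_, by simp [h0], ?_⟩)
  · refine (hf.comp (by fun_prop) fun z hz => hsub (hmap z hz)).add_const _
  · intro z hz
    apply hth
    rw [mem_thickening_iff]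
    refine ⟨_, mem_image_of_mem f (hmap z hz), ?_⟩
    rwa [dist_eq_norm, add_sub_cancel_left, ← dist_eq_norm]
  · rw [hder.deriv, norm_mul, mul_one, Complex.norm_real, Real.norm_of_nonneg htpos.le, mul_comm]

theorem measurable_hypDensity {Ω : Set ℂ} (hO : IsOpen Ω) (hB : Bornology.IsBounded Ω) :
    Measurable (hypDensity Ω) :=
  (lowerSemicontinuous_sSup_discDerivs hO hB).measurable.const_div 1

/-! ### Length estimates for Lipschitz paths -/

theorem LipschitzOnWith.norm_deriv_le_of_mem_Ioo {γ : ℝ → ℂ} {a b : ℝ} {K : ℝ≥0}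
    (hγ : LipschitzOnWith K γ (Icc a b)) {t : ℝ} (ht : t ∈ Ioo a b) : ‖deriv γ t‖ ≤ K :=
  norm_deriv_le_of_lipschitzOn (Icc_mem_nhds ht.1 ht.2) hγ

theorem intervalIntegrable_of_norm_le_Ioo {f : ℝ → ℝ} {a b C : ℝ} (hab : a ≤ b)
    (hf : AEStronglyMeasurable f volume) (hC : ∀ t ∈ Ioo a b, ‖f t‖ ≤ C) :
    IntervalIntegrable f volume a b := by
  rw [intervalIntegrable_iff_integrableOn_Ioo_of_le hab]
  exact Measure.integrableOn_of_bounded (M := C) (by simp) hf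
    (ae_restrict_of_forall_mem measurableSet_Ioo hC)

theorem LipschitzOnWith.intervalIntegrable_norm_deriv {γ : ℝ → ℂ} {a b : ℝ} (hab : a ≤ b)
    {K : ℝ≥0} (hγ : LipschitzOnWith K γ (Icc a b)) :
    IntervalIntegrable (fun t => ‖deriv γ t‖) volume a b :=
  intervalIntegrable_of_norm_le_Ioo hab (measurable_deriv γ).norm.aestronglyMeasurable
    fun t ht => by simpa using hγ.norm_deriv_le_of_mem_Ioo ht

theorem LipschitzOnWith.norm_sub_le_integral_norm_deriv {γ : ℝ → ℂ} {a b : ℝ} (hab : a ≤ b)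
    {K : ℝ≥0} (hγ : LipschitzOnWith K γ (Icc a b)) :
    ‖γ b - γ a‖ ≤ ∫ t in a..b, ‖deriv γ t‖ := by
  rcases eq_or_ne (γ b - γ a) 0 with h0 | h0
  · rw [h0, norm_zero]
    exact intervalIntegral.integral_nonneg hab fun _ _ => norm_nonneg _
  set u := γ b - γ a with hu
  have hupos : 0 < ‖u‖ := norm_pos_iff.2 h0
  let l : ℂ →L[ℝ] ℝ := innerSL ℝ u
  have hl : LipschitzOnWith (‖l‖₊ * K) (fun t => l (γ t)) (uIcc a b) := by
    rw [uIcc_of_le hab]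
    exact l.lipschitz.comp_lipschitzOnWith hγ
  have hac := hl.absolutelyContinuousOnInterval
  have hftc := hac.integral_deriv_eq_sub
  have hdiff : ∀ᵐ t, t ∈ Ioo a b → DifferentiableAt ℝ γ t := by
    filter_upwards [hγ.ae_differentiableWithinAt_of_mem] with t ht htI
    exact (ht (Ioo_subset_Icc_self htI)).differentiableAt (Icc_mem_nhds htI.1 htI.2)
  have hle : ∫ t in a..b, deriv (fun t => l (γ t)) t ≤ ∫ t in a..b, ‖u‖ * ‖deriv γ t‖ := by
    have hi1 := hac.intervalIntegrable_deriv
    have hi2 := (hγ.intervalIntegrable_norm_deriv hab).const_mul ‖u‖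
    rw [intervalIntegral.integral_of_le hab, intervalIntegral.integral_of_le hab,
      integral_Ioc_eq_integral_Ioo, integral_Ioc_eq_integral_Ioo]
    rw [intervalIntegrable_iff_integrableOn_Ioo_of_le hab] at hi1 hi2
    refine integral_mono_ae hi1 hi2 ?_
    rw [EventuallyLE, ae_restrict_iff' measurableSet_Ioo]
    filter_upwards [hdiff] with t ht htI
    have hd : HasDerivAt (fun t => l (γ t)) (l (deriv γ t)) t :=
      l.hasFDerivAt.comp_hasDerivAt t (ht htI).hasDerivAt
    rw [hd.deriv]
    exact real_inner_le_norm u (deriv γ t)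
  rw [hftc, intervalIntegral.integral_const_mul] at hle
  have hval : l (γ b) - l (γ a) = ‖u‖ * ‖u‖ := by
    rw [← map_sub, ← hu]
    exact real_inner_self_eq_norm_mul_norm u
  rw [hval] at hle
  exact le_of_mul_le_mul_left hle hupos

section Admissible

variable {Ω : Set ℂ} {x y : ℂ} {γ : ℝ → ℂ} {a b : ℝ}

theorem qhAdmissible.continuousOn (h : qhAdmissible Ω x y γ a b) : ContinuousOn γ (Icc a b) := by
  obtain ⟨-, -, -, -, K, hK⟩ := h
  exact hK.continuousOn

theorem qhAdmissible.intervalIntegrable_qhLength (hO : IsOpen Ω) (hB : Bornology.IsBounded Ω)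
    (h : qhAdmissible Ω x y γ a b) :
    IntervalIntegrable (fun t => ‖deriv γ t‖ / infDist (γ t) Ωᶜ) volume a b := by
  have hcont := h.continuousOn
  obtain ⟨hab, -, -, hin, K, hK⟩ := h
  have hc : ContinuousOn (fun t => (infDist (γ t) Ωᶜ)⁻¹) (uIcc a b) := by
    rw [uIcc_of_le hab]
    exact ((continuous_infDist_pt _).comp_continuousOn hcont).inv₀ fun t ht =>
      (infDist_compl_pos hO (nonempty_compl_of_isBounded hB) (hin t ht)).ne'
  simpa only [div_eq_mul_inv] using (hK.intervalIntegrable_norm_deriv hab).mul_continuousOn hc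

theorem qhAdmissible.intervalIntegrable_hypLength (hO : IsOpen Ω) (hB : Bornology.IsBounded Ω)
    (h : qhAdmissible Ω x y γ a b) :
    IntervalIntegrable (fun t => hypDensity Ω (γ t) * ‖deriv γ t‖) volume a b := by
  refine (h.intervalIntegrable_qhLength hO hB).mono_fun ?_ ?_
  · rw [uIoc_of_le h.1]
    refine AEMeasurable.aestronglyMeasurable (AEMeasurable.mul ?_ ?_)
    · exact (measurable_hypDensity hO hB).comp_aemeasurable
        ((h.continuousOn.mono Ioc_subset_Icc_self).aemeasurable measurableSet_Ioc)
    · exact (measurable_deriv γ).norm.aemeasurable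
  · rw [uIoc_of_le h.1]
    refine ae_restrict_of_forall_mem measurableSet_Ioc fun t ht => ?_
    have hin := h.2.2.2.1 t (Ioc_subset_Icc_self ht)
    dsimp only
    rw [norm_mul, norm_norm, norm_div, norm_norm, Real.norm_of_nonneg (hypDensity_nonneg _ _),
      Real.norm_of_nonneg infDist_nonneg, mul_comm, div_eq_mul_one_div]
    gcongr
    exact hypDensity_le hO hB hin

theorem qhAdmissible.hypLength_le_qhLength (hO : IsOpen Ω) (hB : Bornology.IsBounded Ω)
    (h : qhAdmissible Ω x y γ a b) : hypLength Ω γ a b ≤ qhLength Ω γ a b := by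
  refine intervalIntegral.integral_mono_on h.1 (h.intervalIntegrable_hypLength hO hB)
    (h.intervalIntegrable_qhLength hO hB) fun t ht => ?_
  rw [mul_comm, div_eq_mul_one_div]
  gcongr
  exact hypDensity_le hO hB (h.2.2.2.1 t ht)

theorem hypLength_nonneg (hab : a ≤ b) : 0 ≤ hypLength Ω γ a b :=
  intervalIntegral.integral_nonneg hab fun _ _ =>
    mul_nonneg (hypDensity_nonneg _ _) (norm_nonneg _)

theorem qhAdmissible.mul_norm_sub_le_hypLength (hO : IsOpen Ω) (hB : Bornology.IsBounded Ω)
    (h : qhAdmissible Ω x y γ a b) {s t m : ℝ} (hm : 0 ≤ m) (has : a ≤ s) (hst : s ≤ t)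
    (htb : t ≤ b) (hle : ∀ u ∈ Ioo s t, m ≤ hypDensity Ω (γ u)) :
    m * ‖γ t - γ s‖ ≤ hypLength Ω γ a b := by
  have hint := h.intervalIntegrable_hypLength hO hB
  obtain ⟨hab, -, -, -, K, hK⟩ := h
  have hsub : Icc s t ⊆ Icc a b := Icc_subset_Icc has htb
  have hKs := hK.mono hsub
  have hints : IntervalIntegrable (fun t => hypDensity Ω (γ t) * ‖deriv γ t‖) volume s t :=
    hint.mono_set (by rwa [uIcc_of_le hst, uIcc_of_le hab])
  calc m * ‖γ t - γ s‖ ≤ m * ∫ u in s..t, ‖deriv γ u‖ := by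
        gcongr; exact hKs.norm_sub_le_integral_norm_deriv hst
    _ = ∫ u in s..t, m * ‖deriv γ u‖ := (intervalIntegral.integral_const_mul _ _).symm
    _ ≤ ∫ u in s..t, hypDensity Ω (γ u) * ‖deriv γ u‖ := by
        refine intervalIntegral.integral_mono_on_of_le_Ioo hst
          ((hKs.intervalIntegrable_norm_deriv hst).const_mul m) hints fun u hu => ?_
        gcongr
        exact hle u hu
    _ ≤ hypLength Ω γ a b :=
        intervalIntegral.integral_mono_interval has hst htb
          (Eventually.of_forall fun u => mul_nonneg (hypDensity_nonneg _ _) (norm_nonneg _)) hint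

end Admissible

theorem exists_crossing {g : ℝ → ℝ} {a b r₁ r₂ : ℝ} (hab : a ≤ b) (hg : ContinuousOn g (Icc a b))
    (ha : g a ≤ r₁) (hb : r₂ ≤ g b) :
    ∃ s t, a ≤ s ∧ s ≤ t ∧ t ≤ b ∧ g s ≤ r₁ ∧ r₂ ≤ g t ∧ ∀ u ∈ Ioo s t, g u ∈ Icc r₁ r₂ := by
  obtain ⟨t, ⟨ht, htr⟩, htmin⟩ := (isCompact_Icc.of_isClosed_subset
    (hg.preimage_isClosed_of_isClosed isClosed_Icc isClosed_Ici)
    inter_subset_left).exists_isLeast (s := Icc a b ∩ g ⁻¹' Ici r₂) ⟨b, ⟨hab, le_rfl⟩, hb⟩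
  have hg' : ContinuousOn g (Icc a t) := hg.mono (Icc_subset_Icc_right ht.2)
  obtain ⟨s, ⟨hs, hsr⟩, hsmax⟩ := (isCompact_Icc.of_isClosed_subset
    (hg'.preimage_isClosed_of_isClosed isClosed_Icc isClosed_Iic)
    inter_subset_left).exists_isGreatest (s := Icc a t ∩ g ⁻¹' Iic r₁) ⟨a, ⟨le_rfl, ht.1⟩, ha⟩
  refine ⟨s, t, hs.1, hs.2, ht.2, hsr, htr, fun u hu => ⟨?_, ?_⟩⟩
  · by_contra! h
    exact absurd (hsmax ⟨⟨hs.1.trans hu.1.le, hu.2.le⟩, h.le⟩) (not_le.2 hu.1)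
  · by_contra! h
    exact absurd (htmin ⟨⟨hs.1.trans hu.1.le, hu.2.le.trans ht.2⟩, h.le⟩) (not_le.2 hu.2)

/-! ### Concatenation and reversal of paths -/

section Paths

variable {Ω : Set ℂ} {x y z : ℂ} {γ γ₁ γ₂ : ℝ → ℂ} {a b c : ℝ}

theorem qhAdmissible.comp_add_const (h : qhAdmissible Ω x y γ a b) (d : ℝ) :
    qhAdmissible Ω x y (fun t => γ (t + d)) (a - d) (b - d) := by
  obtain ⟨hab, ha, hb, hin, K, hK⟩ := h
  have hmaps : MapsTo (fun t => t + d) (Icc (a - d) (b - d)) (Icc a b) :=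
    fun t ht => ⟨by linarith [ht.1], by linarith [ht.2]⟩
  refine ⟨by linarith, by simpa, by simpa, fun t ht => hin _ (hmaps ht), K, ?_⟩
  refine LipschitzOnWith.of_dist_le_mul fun s hs t ht => ?_
  simpa using hK.dist_le_mul _ (hmaps hs) _ (hmaps ht)

theorem hypLength_comp_add_const (d : ℝ) :
    hypLength Ω (fun t => γ (t + d)) (a - d) (b - d) = hypLength Ω γ a b := by
  simp only [hypLength, deriv_comp_add_const]
  simpa using intervalIntegral.integral_comp_add_right (a := a - d) (b := b - d)
    (fun t => hypDensity Ω (γ t) * ‖deriv γ t‖) d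

theorem qhAdmissible.reverse (h : qhAdmissible Ω x y γ a b) :
    qhAdmissible Ω y x (fun t => γ (-t)) (-b) (-a) := by
  obtain ⟨hab, ha, hb, hin, K, hK⟩ := h
  have hmaps : MapsTo (fun t => -t) (Icc (-b) (-a)) (Icc a b) :=
    fun t ht => ⟨by linarith [ht.2], by linarith [ht.1]⟩
  refine ⟨by linarith, by simpa, by simpa, fun t ht => hin _ (hmaps ht), K, ?_⟩
  refine LipschitzOnWith.of_dist_le_mul fun s hs t ht => ?_
  simpa [dist_neg_neg] using hK.dist_le_mul _ (hmaps hs) _ (hmaps ht)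

theorem hypLength_reverse :
    hypLength Ω (fun t => γ (-t)) (-b) (-a) = hypLength Ω γ a b := by
  simp only [hypLength, deriv_comp_neg, norm_neg]
  simpa using intervalIntegral.integral_comp_neg (a := -b) (b := -a)
    (fun t => hypDensity Ω (γ t) * ‖deriv γ t‖)

theorem qhAdmissible.concat (h₁ : qhAdmissible Ω x y γ₁ a b) (h₂ : qhAdmissible Ω y z γ₂ b c) :
    qhAdmissible Ω x z (fun t => if t ≤ b then γ₁ t else γ₂ t) a c := by
  obtain ⟨hab, ha, hb, hin₁, K₁, hK₁⟩ := h₁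
  obtain ⟨hbc, hb', hc, hin₂, K₂, hK₂⟩ := h₂
  have hright : ∀ t, b ≤ t → (if t ≤ b then γ₁ t else γ₂ t) = γ₂ t := by
    intro t ht
    split_ifs with h
    · rw [le_antisymm h ht, hb, hb']
    · rfl
  refine ⟨hab.trans hbc, by simp [hab, ha], (hright c hbc).trans hc, fun t ht => ?_,
    K₁ + K₂, LipschitzOnWith.of_dist_le_mul fun s hs t ht => ?_⟩
  · dsimp only
    split_ifs with h
    · exact hin₁ t ⟨ht.1, h⟩
    · exact hin₂ t ⟨(not_le.1 h).le, ht.2⟩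
  · wlog hst : s ≤ t generalizing s t
    · rw [dist_comm, dist_comm s t]
      exact this t ht s hs (not_le.1 hst).le
    push_cast
    rw [add_mul]
    have n₁ : 0 ≤ (K₁ : ℝ) * dist s t := by positivity
    have n₂ : 0 ≤ (K₂ : ℝ) * dist s t := by positivity
    rcases le_total t b with htb | htb
    · rw [if_pos (hst.trans htb), if_pos htb]
      linarith [hK₁.dist_le_mul s ⟨hs.1, hst.trans htb⟩ t ⟨ht.1, htb⟩]
    rw [hright t htb]
    rcases le_total s b with hsb | hsb
    · rw [if_pos hsb]
      have e₁ := hK₁.dist_le_mul s ⟨hs.1, hsb⟩ b ⟨hab, le_rfl⟩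
      have e₂ := hK₂.dist_le_mul b ⟨le_rfl, hbc⟩ t ⟨htb, ht.2⟩
      have e₃ := dist_triangle (γ₁ s) y (γ₂ t)
      rw [hb] at e₁
      rw [hb'] at e₂
      have d₁ : dist s b ≤ dist s t := by
        rw [dist_comm s b, dist_comm s t, Real.dist_eq, Real.dist_eq, abs_of_nonneg, abs_of_nonneg]
          <;> linarith
      have d₂ : dist b t ≤ dist s t := by
        rw [dist_comm b t, dist_comm s t, Real.dist_eq, Real.dist_eq, abs_of_nonneg, abs_of_nonneg]
          <;> linarith
      have f₁ : (K₁ : ℝ) * dist s b ≤ K₁ * dist s t := by gcongr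
      have f₂ : (K₂ : ℝ) * dist b t ≤ K₂ * dist s t := by gcongr
      linarith
    · rw [hright s hsb]
      linarith [hK₂.dist_le_mul s ⟨hsb, hs.2⟩ t ⟨htb, ht.2⟩]

theorem hypLength_concat (hO : IsOpen Ω) (hB : Bornology.IsBounded Ω)
    (h₁ : qhAdmissible Ω x y γ₁ a b) (h₂ : qhAdmissible Ω y z γ₂ b c) :
    hypLength Ω (fun t => if t ≤ b then γ₁ t else γ₂ t) a c =
      hypLength Ω γ₁ a b + hypLength Ω γ₂ b c := by
  have hint := (h₁.concat h₂).intervalIntegrable_hypLength hO hB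
  have hab := h₁.1
  have hbc := h₂.1
  rw [hypLength, ← intervalIntegral.integral_add_adjacent_intervals
    (hint.mono_set (by rw [uIcc_of_le hab, uIcc_of_le (hab.trans hbc)]; gcongr))
    (hint.mono_set (by rw [uIcc_of_le hbc, uIcc_of_le (hab.trans hbc)]; gcongr))]
  congr 1
  · refine intervalIntegral.integral_congr_Ioo_of_le hab fun t ht => ?_
    have he : (fun t => if t ≤ b then γ₁ t else γ₂ t) =ᶠ[𝓝 t] γ₁ := by
      filter_upwards [Iio_mem_nhds ht.2] with u hu using if_pos hu.le
    simp only [he.deriv_eq, if_pos ht.2.le]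
  · refine intervalIntegral.integral_congr_Ioo_of_le hbc fun t ht => ?_
    have he : (fun t => if t ≤ b then γ₁ t else γ₂ t) =ᶠ[𝓝 t] γ₂ := by
      filter_upwards [Ioi_mem_nhds ht.1] with u hu using if_neg hu.not_ge
    simp only [he.deriv_eq, if_neg ht.1.not_ge]

theorem exists_qhAdmissible_concat (hO : IsOpen Ω) (hB : Bornology.IsBounded Ω) {d : ℝ}
    (h₁ : qhAdmissible Ω x y γ₁ a b) (h₂ : qhAdmissible Ω y z γ₂ c d) :
    ∃ γ e f, qhAdmissible Ω x z γ e f ∧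
      hypLength Ω γ e f = hypLength Ω γ₁ a b + hypLength Ω γ₂ c d := by
  have h₃ := h₂.comp_add_const (c - b)
  rw [sub_sub_cancel] at h₃
  refine ⟨_, _, _, h₁.concat h₃, ?_⟩
  have e := hypLength_comp_add_const (Ω := Ω) (γ := γ₂) (a := c) (b := d) (c - b)
  rw [sub_sub_cancel] at e
  rw [hypLength_concat hO hB h₁ h₃, e]

theorem qhAdmissible_segment (h : segment ℝ x y ⊆ Ω) :
    qhAdmissible Ω x y (fun t => AffineMap.lineMap x y t) 0 1 := by
  refine ⟨zero_le_one, by simp, by simp, fun t ht => h ?_, nndist x y, ?_⟩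
  · rw [segment_eq_image_lineMap]
    exact mem_image_of_mem _ ht
  · exact (lipschitzWith_lineMap x y).lipschitzOnWith

theorem exists_qhAdmissible (hO : IsOpen Ω) (hC : IsConnected Ω) (hB : Bornology.IsBounded Ω)
    (hx : x ∈ Ω) (hy : y ∈ Ω) : ∃ γ a b, qhAdmissible Ω x y γ a b := by
  refine hC.isPreconnected.induction₂ (fun x y => ∃ γ a b, qhAdmissible Ω x y γ a b)
    (fun u hu => ?_) ?_ ?_ hx hy
  · obtain ⟨r, hr, hrΩ⟩ := Metric.isOpen_iff.1 hO u hu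
    filter_upwards [mem_nhdsWithin_of_mem_nhds (ball_mem_nhds u hr)] with v hv
    exact ⟨_, _, _, qhAdmissible_segment
      (((convex_ball u r).segment_subset (mem_ball_self hr) hv).trans hrΩ)⟩
  · rintro u v w - - - ⟨γ₁, a, b, h₁⟩ ⟨γ₂, c, d, h₂⟩
    obtain ⟨γ, e, f, h, -⟩ := exists_qhAdmissible_concat hO hB h₁ h₂
    exact ⟨γ, e, f, h⟩
  · rintro u v - - ⟨γ, a, b, h⟩
    exact ⟨_, _, _, h.reverse⟩

end Paths

/-! ### The hyperbolic distance -/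

section HypDist

variable {Ω : Set ℂ} {x y z : ℂ}

theorem hypDist_le_hypLength {γ : ℝ → ℂ} {a b : ℝ} (h : qhAdmissible Ω x y γ a b) :
    hypDist Ω x y ≤ hypLength Ω γ a b := by
  refine csInf_le ⟨0, ?_⟩ ⟨γ, a, b, h, rfl⟩
  rintro _ ⟨γ, a, b, h, rfl⟩
  exact hypLength_nonneg h.1

theorem hypDist_nonneg (Ω : Set ℂ) (x y : ℂ) : 0 ≤ hypDist Ω x y := by
  refine Real.sInf_nonneg ?_
  rintro _ ⟨γ, a, b, h, rfl⟩
  exact hypLength_nonneg h.1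

theorem le_hypDist (hO : IsOpen Ω) (hC : IsConnected Ω) (hB : Bornology.IsBounded Ω)
    (hx : x ∈ Ω) (hy : y ∈ Ω) {m : ℝ}
    (h : ∀ γ a b, qhAdmissible Ω x y γ a b → m ≤ hypLength Ω γ a b) : m ≤ hypDist Ω x y := by
  obtain ⟨γ, a, b, hγ⟩ := exists_qhAdmissible hO hC hB hx hy
  refine le_csInf ⟨_, γ, a, b, hγ, rfl⟩ ?_
  rintro _ ⟨γ, a, b, h', rfl⟩
  exact h γ a b h'

theorem hypDist_le_qhDist (hO : IsOpen Ω) (hC : IsConnected Ω) (hB : Bornology.IsBounded Ω)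
    (hx : x ∈ Ω) (hy : y ∈ Ω) : hypDist Ω x y ≤ qhDist Ω x y := by
  obtain ⟨γ, a, b, hγ⟩ := exists_qhAdmissible hO hC hB hx hy
  refine le_csInf ⟨_, γ, a, b, hγ, rfl⟩ ?_
  rintro _ ⟨γ, a, b, h, rfl⟩
  exact (hypDist_le_hypLength h).trans (h.hypLength_le_qhLength hO hB)

theorem hypDist_le_swap (hO : IsOpen Ω) (hC : IsConnected Ω) (hB : Bornology.IsBounded Ω)
    (hx : x ∈ Ω) (hy : y ∈ Ω) : hypDist Ω x y ≤ hypDist Ω y x :=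
  le_hypDist hO hC hB hy hx fun _ _ _ h =>
    (hypDist_le_hypLength h.reverse).trans_eq hypLength_reverse

theorem hypDist_triangle (hO : IsOpen Ω) (hC : IsConnected Ω) (hB : Bornology.IsBounded Ω)
    (hx : x ∈ Ω) (hy : y ∈ Ω) (hz : z ∈ Ω) :
    hypDist Ω x z ≤ hypDist Ω x y + hypDist Ω y z := by
  rw [← sub_le_iff_le_add]
  refine le_hypDist hO hC hB hx hy fun γ₁ a b h₁ => ?_
  rw [sub_le_comm]
  refine le_hypDist hO hC hB hy hz fun γ₂ c d h₂ => ?_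
  obtain ⟨γ, e, f, h, hl⟩ := exists_qhAdmissible_concat hO hB h₁ h₂
  linarith [hypDist_le_hypLength h]

theorem norm_sub_le_hypDist (hO : IsOpen Ω) (hC : IsConnected Ω) (hB : Bornology.IsBounded Ω)
    {R : ℝ} (hR0 : 0 < R) (hR : ∀ z ∈ Ω, ‖z‖ ≤ R) (hx : x ∈ Ω) (hy : y ∈ Ω) :
    ‖y - x‖ ≤ 2 * R * hypDist Ω x y := by
  have h : 1 / (2 * R) * ‖y - x‖ ≤ hypDist Ω x y := by
    refine le_hypDist hO hC hB hx hy fun γ a b hγ => ?_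
    have := hγ.mul_norm_sub_le_hypLength hO hB (m := 1 / (2 * R)) (by positivity) le_rfl hγ.1
      le_rfl fun u hu => le_hypDensity hO hB (hγ.2.2.2.1 u (Ioo_subset_Icc_self hu))
        fun r hr => le_of_mem_discDerivs hR hr
    rwa [hγ.2.1, hγ.2.2.1] at this
  rwa [one_div, inv_mul_le_iff₀ (by positivity)] at h

/-- A point at Euclidean distance `10 δ(x)` from `x` is either at definite hyperbolic distance from
`x` or at least twice as far from the boundary as `x`. -/
theorem two_mul_infDist_le_or_le_hypDist (hO : IsOpen Ω) (hC : IsConnected Ω)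
    (hB : Bornology.IsBounded Ω) (hx : x ∈ Ω) (hy : y ∈ Ω)
    (hxy : ‖y - x‖ = 10 * infDist x Ωᶜ) :
    2 * infDist x Ωᶜ ≤ infDist y Ωᶜ ∨ 1 / 40000 ≤ hypDist Ω x y := by
  have hne := nonempty_compl_of_isBounded hB
  by_cases! hlt : 2 * infDist x Ωᶜ ≤ infDist y Ωᶜ
  · exact Or.inl hlt
  right
  have hδ := infDist_compl_pos hO hne hx
  obtain ⟨a, ha, hxa⟩ := hO.isClosed_compl.exists_infDist_eq_dist hne x
  obtain ⟨b, hb, hyb⟩ := hO.isClosed_compl.exists_infDist_eq_dist hne y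
  rw [dist_eq_norm] at hxa hyb
  set δ := infDist x Ωᶜ with hδdef
  have h₁ : ‖b - a‖ ≤ 13 * δ := by
    have e : b - a = (y - x) + (x - a) - (y - b) := by ring
    rw [e]
    linarith [norm_sub_le ((y - x) + (x - a)) (y - b), norm_add_le (y - x) (x - a)]
  have h₂ : 7 * δ ≤ ‖b - a‖ := by
    have e : y - x = (b - a) + (y - b) - (x - a) := by ring
    have := norm_sub_le ((b - a) + (y - b)) (x - a)
    rw [← e] at this
    linarith [norm_add_le (b - a) (y - b)]
  have h₃ : 9 * δ ≤ ‖y - a‖ := by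
    have := norm_sub_le (y - a) (x - a)
    rw [sub_sub_sub_cancel_right] at this
    linarith
  have hn : 0 < ‖b - a‖ := by linarith
  have hab : a ≠ b := by
    rintro rfl
    simp at hn
  refine le_hypDist hO hC hB hx hy fun γ s₀ t₀ hγ => ?_
  obtain ⟨s, t, hs, hst, ht, hgs, hgt, hu⟩ := exists_crossing (g := fun t => ‖γ t - a‖)
    (r₁ := ‖b - a‖ / 4) (r₂ := ‖b - a‖ / 2) hγ.1 (hγ.continuousOn.sub continuousOn_const).norm
    (by rw [hγ.2.1]; linarith) (by rw [hγ.2.2.1]; linarith)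
  have hlen := hγ.mul_norm_sub_le_hypLength hO hB (m := 1 / (10000 * ‖b - a‖)) (by positivity)
    hs hst ht fun u hu' => le_hypDensity_of_notMem hO hB ha hb hab
      (hγ.2.2.2.1 u ⟨hs.trans hu'.1.le, hu'.2.le.trans ht⟩) (hu u hu').1 (hu u hu').2
  have hd : ‖b - a‖ / 4 ≤ ‖γ t - γ s‖ := by
    have := norm_sub_norm_le (γ t - a) (γ s - a)
    rw [sub_sub_sub_cancel_right] at this
    linarith
  calc (1 / 40000 : ℝ) = 1 / (10000 * ‖b - a‖) * (‖b - a‖ / 4) := by field_simp; norm_num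
    _ ≤ 1 / (10000 * ‖b - a‖) * ‖γ t - γ s‖ := by gcongr
    _ ≤ _ := hlen

end HypDist

/-! ### The visibility argument -/

theorem norm_sub_le_add_integral_of_doubling {γ : ℝ → ℂ} {D W : ℝ → ℝ} {T c L d ε : ℝ}
    (hT : 0 ≤ T) (hc : 0 < c) (hL : 0 < L) (hd : 0 < d)
    (hγ : ∀ s ∈ Icc 0 T, ∀ t ∈ Icc 0 T, ‖γ t - γ s‖ ≤ L * |t - s|)
    (hdD : ∀ t ∈ Icc 0 T, d ≤ D t) (hDε : ∀ t ∈ Icc 0 T, D t ≤ ε)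
    (hstep : ∀ s ∈ Icc 0 T, ∀ t ∈ Icc 0 T, s ≤ t → ‖γ t - γ s‖ = 10 * D s →
      2 * D s ≤ D t ∨ c ≤ t - s)
    (hW0 : ∀ t, 0 ≤ W t) (hW : IntervalIntegrable W volume 0 T)
    (hDW : ∀ s ∈ Icc 0 T, ∀ t ∈ Icc 0 T, s ≤ t → t ≤ s + c → D s ≤ W t) :
    ‖γ T - γ 0‖ ≤ 20 * ε + 20 / c * ∫ t in (0 : ℝ)..T, W t := by
  have hsub : ∀ s ∈ Icc 0 T, ∀ t ∈ Icc 0 T, IntervalIntegrable W volume s t :=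
    fun s hs t ht => hW.mono_set (by
      rw [uIcc_of_le hT]
      exact (ordConnected_Icc.uIcc_subset hs ht))
  have hnn : ∀ s t, s ≤ t → 0 ≤ ∫ u in s..t, W u :=
    fun s t hst => intervalIntegral.integral_nonneg hst fun u _ => hW0 u
  have hTm : T ∈ Icc 0 T := right_mem_Icc.2 hT
  have hcont : ContinuousOn γ (Icc 0 T) := by
    refine (LipschitzOnWith.of_dist_le_mul (K := L.toNNReal) fun s hs t ht => ?_).continuousOn
    rw [Real.coe_toNNReal _ hL.le, dist_eq_norm, Real.dist_eq]
    exact hγ t ht s hs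
  have key : ∀ n : ℕ, ∀ s ∈ Icc 0 T, T - s ≤ n * (10 * d / L) →
      ‖γ T - γ s‖ + 10 * D s ≤ 20 * ε + 20 / c * ∫ u in s..T, W u := by
    intro n
    induction n with
    | zero =>
      intro s hs hn
      have : s = T := le_antisymm hs.2 (by simpa using hn)
      subst this
      simp only [sub_self, norm_zero, zero_add, intervalIntegral.integral_same, mul_zero, add_zero]
      linarith [hDε s hs, hdD s hs]
    | succ n ih =>
      intro s hs hn
      have hI : 0 ≤ 20 / c * ∫ u in s..T, W u := mul_nonneg (by positivity) (hnn s T hs.2)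
      rcases le_or_gt ‖γ T - γ s‖ (10 * D s) with hle | hgt
      · linarith [hDε s hs]
      obtain ⟨t, ht, hts⟩ := intermediate_value_Icc (f := fun u => ‖γ u - γ s‖) hs.2
        ((hcont.mono (Icc_subset_Icc_left hs.1)).sub continuousOn_const).norm
        (show 10 * D s ∈ _ from ⟨by simp; linarith [hdD s hs], hgt.le⟩)
      have ht0 : t ∈ Icc 0 T := ⟨hs.1.trans ht.1, ht.2⟩
      dsimp only at hts
      have hstep1 : 10 * d / L ≤ t - s := by
        rw [div_le_iff₀ hL]
        have := hγ s hs t ht0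
        rw [abs_of_nonneg (by linarith [ht.1])] at this
        linarith [hdD s hs]
      have hih := ih t ht0 (by push_cast at hn; linarith)
      have htri : ‖γ T - γ s‖ ≤ ‖γ T - γ t‖ + 10 * D s := by
        rw [← hts]
        exact norm_sub_le_norm_sub_add_norm_sub _ _ _
      have hadd := intervalIntegral.integral_add_adjacent_intervals
        (hsub s hs t ht0) (hsub t ht0 T hTm)
      rw [← hadd, mul_add]
      rcases hstep s hs t ht0 ht.1 hts with h2 | h2
      · have : 0 ≤ 20 / c * ∫ u in s..t, W u := mul_nonneg (by positivity) (hnn s t ht.1)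
        linarith
      · have hsc : s + c ∈ Icc 0 T := ⟨by linarith [hs.1], by linarith [ht.2]⟩
        have h3 := intervalIntegral.integral_add_adjacent_intervals
          (hsub s hs (s + c) hsc) (hsub (s + c) hsc t ht0)
        have h4 := hnn (s + c) t (by linarith)
        have h5 : c * D s ≤ ∫ u in s..(s + c), W u := by
          have := intervalIntegral.integral_mono_on (f := fun _ => D s) (g := W)
            (by linarith : s ≤ s + c) intervalIntegrable_const (hsub s hs (s + c) hsc)
            fun u hu => hDW s hs u ⟨hs.1.trans hu.1, hu.2.trans hsc.2⟩ hu.1 hu.2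
          simpa using this
        have h6 : 20 * D s ≤ 20 / c * ∫ u in s..t, W u := by
          rw [div_mul_eq_mul_div, le_div_iff₀ hc]
          linarith
        linarith [hdD t ht0]
  obtain ⟨n, hn⟩ := exists_nat_ge (T / (10 * d / L))
  have := key n 0 (left_mem_Icc.2 hT) (by
    rw [sub_zero]
    rwa [div_le_iff₀ (by positivity)] at hn)
  linarith [hdD 0 (left_mem_Icc.2 hT)]

theorem exists_setIntegral_min_le {G : ℝ → ℝ} (hG : IntegrableOn G (Ioi 0)) (hG0 : ∀ v, 0 ≤ G v)
    {η m : ℝ} (hη : 0 < η) (hm : 0 < m) :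
    ∃ ε, 0 < ε ∧ ε ≤ m ∧ ∫ v in Ioi 0, min ε (G v) ≤ η := by
  have hlim : Tendsto (fun ε : ℝ => ∫ v in Ioi 0, min ε (G v)) (𝓝[>] 0)
      (𝓝 (∫ _ in Ioi (0 : ℝ), (0 : ℝ))) := by
    refine tendsto_integral_filter_of_dominated_convergence G ?_ ?_ hG ?_
    · exact Eventually.of_forall fun ε => aestronglyMeasurable_const.inf hG.aestronglyMeasurable
    · filter_upwards [self_mem_nhdsWithin] with ε hε
      refine Eventually.of_forall fun v => ?_
      rw [Real.norm_of_nonneg (le_min (le_of_lt hε) (hG0 v))]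
      exact min_le_right _ _
    · refine Eventually.of_forall fun v => ?_
      have : Tendsto (fun ε : ℝ => min ε (G v)) (𝓝 0) (𝓝 (min 0 (G v))) :=
        (continuous_id.min continuous_const).tendsto 0
      rw [min_eq_left (hG0 v)] at this
      exact this.mono_left nhdsWithin_le_nhds
  rw [integral_zero] at hlim
  have h₁ := hlim.eventually (Iio_mem_nhds hη)
  have h₂ : ∀ᶠ ε : ℝ in 𝓝[>] 0, ε ∈ Ioo 0 m := Ioo_mem_nhdsGT hm
  obtain ⟨ε, h, h'⟩ := (h₁.and h₂).exists
  exact ⟨ε, h'.1, h'.2.le, le_of_lt h⟩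

theorem intervalIntegral_comp_abs_sub_le {F : ℝ → ℝ} (hF : IntegrableOn F (Ioi 0))
    (hF0 : ∀ v, 0 ≤ F v) {a b : ℝ} (hab : a ≤ b) (t₀ : ℝ) :
    IntervalIntegrable (fun t => F |t - t₀|) volume a b ∧
      ∫ t in a..b, F |t - t₀| ≤ 2 * ∫ v in Ioi 0, F v := by
  have hpos : IntegrableOn (fun t => F |t|) (Ioi 0) :=
    hF.congr_fun (fun t ht => by rw [abs_of_pos ht]) measurableSet_Ioi
  have hneg : IntegrableOn (fun t => F |t|) (Iic 0) := by
    have := (integrable_indicator_iff measurableSet_Ici).2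
      (Iff.mpr integrableOn_Ici_iff_integrableOn_Ioi hpos) |>.comp_neg
    refine ((integrable_indicator_iff measurableSet_Iic).1 (this.congr ?_))
    refine Eventually.of_forall fun t => ?_
    simp [indicator_apply]
  have hi : Integrable (fun t => F |t|) := by
    rw [← integrableOn_univ, ← Iic_union_Ioi (a := (0 : ℝ))]
    exact hneg.union hpos
  have hi' : Integrable (fun t => F |t - t₀|) := hi.comp_sub_right t₀
  refine ⟨hi'.intervalIntegrable, ?_⟩
  rw [← integral_comp_abs, ← integral_sub_right_eq_self (fun t => F |t|) t₀,
    intervalIntegral.integral_of_le hab]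
  exact setIntegral_le_integral hi' (Eventually.of_forall fun t => hF0 _)

theorem exists_antitone_majorant {φ ψ : ℝ → ℝ} (hφpos : ∀ t ∈ Ioi (0 : ℝ), 0 < φ t)
    (hψmono : MonotoneOn ψ (Ioi 0)) (hψinv : ∀ s ∈ Ioi (0 : ℝ), ψ (φ s) = s)
    (hint : IntegrableOn (fun t => 1 / ψ t) (Ioi 0)) {δ c : ℝ} (hδ : 0 < δ) (hc : 0 < c) :
    ∃ G : ℝ → ℝ, IntegrableOn G (Ioi 0) ∧ (∀ v, 0 ≤ G v) ∧ Antitone G ∧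
      ∀ r D, 0 < D → D ≤ δ → (r - 1) / 2 ≤ φ (δ / D) → D ≤ G (r + c) := by
  have hone : (1 : ℝ) ∈ Ioi 0 := mem_Ioi.2 one_pos
  have h1 : 0 < φ 1 := hφpos 1 hone
  have hψ1 : ∀ u, φ 1 ≤ u → 1 ≤ ψ u := fun u hu => by
    have := hψmono (show φ 1 ∈ Ioi 0 from h1) (show u ∈ Ioi 0 from h1.trans_le hu) hu
    rwa [hψinv 1 hone] at this
  set V := 2 * φ 1 + (c + 1) with hV
  have hV0 : 0 ≤ V := by positivity
  have hu : ∀ v, V < v → φ 1 < (v - (c + 1)) / 2 := fun v hv => by linarith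
  refine ⟨fun v => if v ≤ V then δ else δ / ψ ((v - (c + 1)) / 2), ?_, fun v => ?_,
    fun v w hvw => ?_, fun r D hD hDδ hr => ?_⟩
  · rw [← Ioc_union_Ioi_eq_Ioi hV0]
    refine IntegrableOn.union ?_ ?_
    · refine (integrableOn_const (C := δ) (by simp)).congr_fun (fun v hv => ?_) measurableSet_Ioc
      rw [if_pos hv.2]
    · have := (((integrable_indicator_iff measurableSet_Ioi).2 hint).comp_div
        (two_ne_zero)).comp_sub_right (c + 1) |>.const_mul δ
      refine this.integrableOn.congr_fun (fun v hv => ?_) measurableSet_Ioi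
      have hv' := hu v hv
      rw [if_neg (not_le.2 hv)]
      dsimp only
      rw [indicator_of_mem (mem_Ioi.2 (h1.trans hv')), mul_one_div]
  · dsimp only
    split_ifs with h
    · exact hδ.le
    · exact div_nonneg hδ.le (zero_le_one.trans (hψ1 _ (hu v (not_le.1 h)).le))
  · dsimp only
    split_ifs with h h' h'
    · exact le_rfl
    · linarith
    · exact div_le_self hδ.le (hψ1 _ (hu w (not_le.1 h)).le)
    · have h₁ := hu v (not_le.1 h')
      have h₂ := hu w (not_le.1 h)
      have := hψ1 _ h₁.le
      refine div_le_div_of_nonneg_left hδ.le (by linarith)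
        (hψmono (h1.trans h₁) (h1.trans h₂) (by linarith))
  · dsimp only
    split_ifs with h
    · exact hDδ
    · have h₁ := hu _ (not_le.1 h)
      rw [show (r + c - (c + 1)) / 2 = (r - 1) / 2 by ring] at h₁ ⊢
      have h₂ := hψmono (h1.trans h₁) (h1.trans (h₁.trans_le hr)) hr
      rw [hψinv _ (div_pos hδ hD), le_div_iff₀ hD] at h₂
      rw [le_div_iff₀ (one_pos.trans_le (hψ1 _ h₁.le)), mul_comm]
      exact h₂

/-- Hyperbolic geodesics staying in the `ε`-neighbourhood of the boundary have endpoints that are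
close to each other. -/
theorem IsHypGeodesicOn.norm_sub_le {Ω : Set ℂ} (hO : IsOpen Ω) (hC : IsConnected Ω)
    (hB : Bornology.IsBounded Ω) {x₀ : ℂ} (hx₀ : x₀ ∈ Ω) {φ G : ℝ → ℝ} {c ε : ℝ}
    (hgrowth : ∀ x ∈ Ω, qhDist Ω x₀ x ≤ φ (infDist x₀ Ωᶜ / infDist x Ωᶜ))
    (hc : 0 < c) (hc' : c ≤ 1 / 40000) (hG : IntegrableOn G (Ioi 0)) (hG0 : ∀ v, 0 ≤ G v)
    (hGanti : Antitone G)
    (hGφ : ∀ r D, 0 < D → D ≤ infDist x₀ Ωᶜ → (r - 1) / 2 ≤ φ (infDist x₀ Ωᶜ / D) →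
      D ≤ G (r + c))
    (hε : 0 < ε) (hε' : ε ≤ infDist x₀ Ωᶜ) {γ : ℝ → ℂ} {T : ℝ} (hT : 0 ≤ T)
    (hγ : IsHypGeodesicOn Ω γ (Icc 0 T)) (hDε : ∀ t ∈ Icc 0 T, infDist (γ t) Ωᶜ ≤ ε) :
    ‖γ T - γ 0‖ ≤ 20 * ε + 20 / c * (2 * ∫ v in Ioi 0, min ε (G v)) := by
  obtain ⟨hin, hgeo⟩ := hγ
  obtain ⟨R, hR0, hR⟩ := hB.exists_pos_norm_le
  have hne := nonempty_compl_of_isBounded hB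
  have hLip : ∀ s ∈ Icc 0 T, ∀ t ∈ Icc 0 T, ‖γ t - γ s‖ ≤ 2 * R * |t - s| := fun s hs t ht => by
    rw [abs_sub_comm, ← hgeo s hs t ht]
    exact norm_sub_le_hypDist hO hC hB hR0 hR (hin s hs) (hin t ht)
  have hcont : ContinuousOn γ (Icc 0 T) := by
    refine (LipschitzOnWith.of_dist_le_mul (K := (2 * R).toNNReal)
      fun s hs t ht => ?_).continuousOn
    rw [Real.coe_toNNReal _ (by positivity), dist_eq_norm, Real.dist_eq]
    exact hLip t ht s hs
  obtain ⟨t₁, ht₁, hmin⟩ := isCompact_Icc.exists_isMinOn (nonempty_Icc.2 hT)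
    ((continuous_infDist_pt Ωᶜ).comp_continuousOn hcont)
  obtain ⟨_, ⟨t₀, ht₀, rfl⟩, hlt⟩ := Real.lt_sInf_add_pos
    ((nonempty_Icc.2 hT).image fun t => hypDist Ω x₀ (γ t)) one_pos
  have hnear : ∀ t ∈ Icc 0 T, (|t - t₀| - 1) / 2 ≤ hypDist Ω x₀ (γ t) := fun t ht => by
    have h₁ : sInf (Set.image (fun t => hypDist Ω x₀ (γ t)) (Icc 0 T)) ≤ hypDist Ω x₀ (γ t) := by
      refine csInf_le ⟨0, ?_⟩ ⟨t, ht, rfl⟩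
      rintro _ ⟨u, -, rfl⟩
      exact hypDist_nonneg _ _ _
    have h₂ := hypDist_triangle hO hC hB (hin t₀ ht₀) hx₀ (hin t ht)
    have h₃ := hypDist_le_swap hO hC hB (hin t₀ ht₀) hx₀
    rw [hgeo t₀ ht₀ t ht, abs_sub_comm] at h₂
    linarith
  have hDG : ∀ t ∈ Icc 0 T, infDist (γ t) Ωᶜ ≤ G (|t - t₀| + c) := fun t ht =>
    hGφ _ _ (infDist_compl_pos hO hne (hin t ht)) ((hDε t ht).trans hε')
      ((hnear t ht).trans ((hypDist_le_qhDist hO hC hB hx₀ (hin t ht)).trans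
        (hgrowth _ (hin t ht))))
  have hF0 : ∀ v, 0 ≤ min ε (G v) := fun v => le_min hε.le (hG0 v)
  have hF : IntegrableOn (fun v => min ε (G v)) (Ioi 0) := by
    refine hG.mono' (aestronglyMeasurable_const.inf hG.aestronglyMeasurable)
      (Eventually.of_forall fun v => ?_)
    rw [Real.norm_of_nonneg (hF0 v)]
    exact min_le_right _ _
  obtain ⟨hWi, hWle⟩ := intervalIntegral_comp_abs_sub_le hF hF0 hT t₀
  refine (norm_sub_le_add_integral_of_doubling (D := fun t => infDist (γ t) Ωᶜ)
    (W := fun t => min ε (G |t - t₀|)) (L := 2 * R) hT hc (by positivity)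
    (infDist_compl_pos hO hne (hin t₁ ht₁)) hLip (fun t ht => hmin ht) hDε
    (fun s hs t ht hst h => ?_) (fun t => hF0 _) hWi
    fun s hs t ht hst htc => le_min (hDε s hs) ((hDG s hs).trans (hGanti ?_))).trans ?_
  · refine (two_mul_infDist_le_or_le_hypDist hO hC hB (hin s hs) (hin t ht) h).imp_right
      fun h' => ?_
    rw [hgeo s hs t ht, abs_sub_comm, abs_of_nonneg (by linarith)] at h'
    exact hc'.trans h'
  · have := abs_sub_le t s t₀
    rw [abs_of_nonneg (by linarith : 0 ≤ t - s)] at this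
    linarith
  · gcongr

/-- Let `Ω ⊆ ℂ` be a bounded hyperbolic domain, `x₀ ∈ Ω`, and
`φ : (0,∞) → (0,∞)` strictly increasing with `φ(t) → ∞` as `t → ∞`, whose inverse
`ψ = φ⁻¹` satisfies `∫_0^∞ dt / φ⁻¹(t) < ∞`. If the quasihyperbolic metric satisfies
`k_Ω(x₀, x) ≤ φ(δ_Ω(x₀) / δ_Ω(x))` for all `x ∈ Ω`, then `Ω` is an H-visibility domain. -/
theorem statement10 (Ω : Set ℂ)
    (hOpen : IsOpen Ω) (hConn : IsConnected Ω) (hBdd : Bornology.IsBounded Ω)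
    (hHyp : IsHyperbolicDomain Ω)
    (x₀ : ℂ) (hx₀ : x₀ ∈ Ω)
    (φ ψ : ℝ → ℝ)
    (hφmono : StrictMonoOn φ (Ioi 0))
    (hφpos : ∀ t ∈ Ioi (0 : ℝ), 0 < φ t)
    (hφtop : Tendsto φ atTop atTop)
    (hψmono : MonotoneOn ψ (Ioi 0))
    (hψinv : ∀ s ∈ Ioi (0 : ℝ), ψ (φ s) = s)
    (hint : IntegrableOn (fun t => 1 / ψ t) (Ioi 0))
    (hgrowth : ∀ x ∈ Ω, qhDist Ω x₀ x ≤ φ (infDist x₀ Ωᶜ / infDist x Ωᶜ)) :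
    HVisibilityDomain Ω := by
  have hδ := infDist_compl_pos hOpen (nonempty_compl_of_isBounded hBdd) hx₀
  have hc : (0 : ℝ) < 1 / 40000 := by norm_num
  obtain ⟨G, hG, hG0, hGanti, hGφ⟩ := exists_antitone_majorant hφpos hψmono hψinv hint hδ hc
  intro p _ q _ hpq
  have hd : 0 < dist p q := dist_pos.2 hpq
  obtain ⟨ε, hε, hεm, hεη⟩ := exists_setIntegral_min_le hG hG0
    (η := 1 / 40000 * dist p q / 480) (m := min (infDist x₀ Ωᶜ) (dist p q / 480))
    (by positivity) (by positivity)
  refine ⟨ball p (dist p q / 3), ball q (dist p q / 3), isOpen_ball, isOpen_ball,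
    mem_ball_self (by positivity), mem_ball_self (by positivity), ?_,
    {z | ε ≤ infDist z Ωᶜ}, ?_, fun z hz => ?_, fun γ T hT hγ h₀ h₁ => ?_⟩
  · exact disjoint_iff_inter_eq_empty.1 ((closedBall_disjoint_closedBall (by linarith)).mono
      closure_ball_subset_closedBall closure_ball_subset_closedBall)
  · refine isCompact_of_isClosed_isBounded
      (isClosed_le continuous_const (continuous_infDist_pt _)) (hBdd.subset fun z hz => ?_)
    by_contra h
    exact absurd (hε.trans_le hz) (by rw [infDist_zero_of_mem h]; exact lt_irrefl 0)
  · by_contra h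
    exact absurd (hε.trans_le hz) (by rw [infDist_zero_of_mem h]; exact lt_irrefl 0)
  · by_contra! hmiss
    have hle := hγ.norm_sub_le hOpen hConn hBdd hx₀ hgrowth hc le_rfl hG hG0 hGanti hGφ hε
      (hεm.trans (min_le_left _ _)) hT fun t ht => (not_le.1 (hmiss t ht)).le
    have hε2 := hεm.trans (min_le_right _ _)
    rw [← dist_eq_norm] at hle
    rw [mem_ball] at h₀ h₁
    have := dist_triangle4 p (γ 0) (γ T) q
    rw [dist_comm p (γ 0), dist_comm (γ 0) (γ T)] at this
    norm_num at hle hεη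
    linarith

end
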